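/- Let 𝔤 be a finite-dimensional semisimple Lie algebra over an algebraically closed field K of characteristic 0, with Cartan subalgebra 𝔥 and base Δ of simple roots, and let V(λ) be the irreducible 𝔤-module of highest weight λ. Then for every simple root α ∈ Δ, setting t := ⟨λ, α⟩, each weight 2λ − t'α with 0 ≤ t' ≤ t is dominant integral, and the tensor square V(λ) ⊗ V(λ) contains a submodule isomorphic to the direct sum V(2λ) ⊕ V(2λ − α) ⊕ ⋯ ⊕ V(2λ − tα). -/

import Mathlib

open scoped TensorProduct

section WeightTheory

variable (K : Type*) [Field K]
variable (𝔤 : Type*) [LieRing 𝔤] [LieAlgebra K 𝔤]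
variable (H : LieSubalgebra K 𝔤)

/-- The weight space `M_μ = {v | h ⬝ v = μ(h) v for all h ∈ H}` of a `𝔤`-module `M`,
for a linear functional `μ` on the Cartan subalgebra `H`. -/
def hWeightSpace (M : Type*) [AddCommGroup M] [Module K M]
    [LieRingModule 𝔤 M] [LieModule K 𝔤 M] (μ : Module.Dual K H) : Submodule K M where
  carrier := {v | ∀ h : H, ⁅(h : 𝔤), v⁆ = μ h • v}
  add_mem' := by
    intro a b ha hb h
    rw [lie_add, ha h, hb h, smul_add]
  zero_mem' := by
    intro h
    simp
  smul_mem' := by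
    intro c a ha h
    rw [lie_smul, ha h, smul_comm]

/-- The root space `𝔤_α` for `α : H →ₗ K`, i.e. the weight space of the adjoint module. -/
def hRootSpace (α : Module.Dual K H) : Submodule K 𝔤 :=
  hWeightSpace K 𝔤 H 𝔤 α

/-- `α` is a root of `𝔤` with respect to the Cartan subalgebra `H` if it is a nonzero
functional with nonzero root space. -/
def IsLieRoot (α : Module.Dual K H) : Prop :=
  α ≠ 0 ∧ hRootSpace K 𝔤 H α ≠ ⊥

/-- `Δ` is a base of simple roots: a linearly independent set of roots such that every root
is an integral linear combination of elements of `Δ` with all coefficients of the same sign. -/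
def IsRootBase (Δ : Finset (Module.Dual K H)) : Prop :=
  (∀ α ∈ Δ, IsLieRoot K 𝔤 H α) ∧
    LinearIndependent K (fun a : (Δ : Set (Module.Dual K H)) => (a : Module.Dual K H)) ∧
    ∀ β : Module.Dual K H, IsLieRoot K 𝔤 H β →
      ∃ c : Module.Dual K H → ℤ, β = ∑ α ∈ Δ, c α • α ∧
        ((∀ α ∈ Δ, 0 ≤ c α) ∨ (∀ α ∈ Δ, c α ≤ 0))

/-- `hα ∈ H` is the coroot of the root `α`: it satisfies `α(hα) = 2` and lies in
`[𝔤_α, 𝔤_{-α}]`, so that `⟨λ, α⟩ = 2(λ,α)/(α,α) = λ(hα)` for every weight `λ`. -/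
def IsCoroot (α : Module.Dual K H) (hα : H) : Prop :=
  α hα = 2 ∧ ∃ e ∈ hRootSpace K 𝔤 H α, ∃ f ∈ hRootSpace K 𝔤 H (-α), ⁅e, f⁆ = (hα : 𝔤)

/-- `v` is a highest weight vector of weight `λ` (with respect to the base `Δ`):
it is a nonzero vector of weight `λ` killed by all the simple root spaces. -/
def IsHighestWeightVector (Δ : Finset (Module.Dual K H))
    (M : Type*) [AddCommGroup M] [Module K M] [LieRingModule 𝔤 M] [LieModule K 𝔤 M]
    (lam : Module.Dual K H) (v : M) : Prop :=
  v ≠ 0 ∧ v ∈ hWeightSpace K 𝔤 H M lam ∧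
    ∀ α ∈ Δ, ∀ e ∈ hRootSpace K 𝔤 H α, ⁅e, v⁆ = 0

/-- `M` has highest weight `λ` (with respect to the base `Δ`). -/
def IsHighestWeight (Δ : Finset (Module.Dual K H))
    (M : Type*) [AddCommGroup M] [Module K M] [LieRingModule 𝔤 M] [LieModule K 𝔤 M]
    (lam : Module.Dual K H) : Prop :=
  ∃ v : M, IsHighestWeightVector K 𝔤 H Δ M lam v

end WeightTheory

namespace LieAlgebra

variable {K L : Type*} [Field K] [LieRing L] [LieAlgebra K L]

/-- A semisimple Lie algebra is perfect. -/
lemma lie_top_top_eq_top [LieAlgebra.IsSemisimple K L] :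
    ⁅(⊤ : LieIdeal K L), (⊤ : LieIdeal K L)⁆ = ⊤ := by
  obtain ⟨J, hJ⟩ := exists_isCompl ⁅(⊤ : LieIdeal K L), (⊤ : LieIdeal K L)⁆
  have hJ0 : J = ⊥ := by
    refine (LieAlgebra.hasTrivialRadical_iff_no_abelian_ideals K L).1 inferInstance J ?_
    rw [LieSubmodule.lie_abelian_iff_lie_self_eq_bot, eq_bot_iff, ← hJ.inf_eq_bot]
    exact le_inf (LieSubmodule.mono_lie le_top le_top) (LieSubmodule.lie_le_right _ _)
  simpa [hJ0] using hJ.sup_eq_top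

end LieAlgebra

namespace LieModule

variable {K L E : Type*} [Field K] [LieRing L] [LieAlgebra K L]
    [AddCommGroup E] [Module K E] [LieRingModule L E] [LieModule K L E]

/-- A semisimple Lie algebra acts trivially on a module with vanishing trace form. -/
lemma lie_eq_zero_of_traceForm_eq_zero [CharZero K] [LieAlgebra.IsSemisimple K L]
    [FiniteDimensional K E] (h : traceForm K L E = 0) (x : L) (m : E) : ⁅x, m⁆ = 0 := by
  have hn := isNilpotent_derivedSeries_of_traceForm_eq_zero (R := K) (L := L) (M := E) h
  have h1 : LieAlgebra.derivedSeries K L 1 = ⊤ := by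
    simpa [LieAlgebra.derivedSeries_def] using LieAlgebra.lie_top_top_eq_top
  rw [h1] at hn
  obtain ⟨k, hk⟩ := (LieModule.isNilpotent_iff K _ _).1 hn
  have hk' : LieIdeal.lcs (⊤ : LieIdeal K L) E k = ⊥ := by
    rw [← LieSubmodule.toSubmodule_inj, LieIdeal.coe_lcs_eq, hk]; rfl
  have key : ∀ n, ∀ (x : L) (m : E), ⁅x, m⁆ ∈ LieIdeal.lcs (⊤ : LieIdeal K L) E n := by
    intro n
    induction n with
    | zero => simp
    | succ n ih =>
      intro x m
      rw [LieIdeal.lcs_succ]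
      have hx : x ∈ ⁅(⊤ : LieIdeal K L), (⊤ : LieIdeal K L)⁆ := by
        rw [LieAlgebra.lie_top_top_eq_top]; trivial
      rw [← LieSubmodule.mem_toSubmodule, LieSubmodule.lieIdeal_oper_eq_linear_span'] at hx
      induction hx using Submodule.span_induction with
      | mem y hy =>
        obtain ⟨a, -, b, -, rfl⟩ := hy
        rw [lie_lie]
        exact sub_mem (LieSubmodule.lie_mem_lie trivial (ih b m))
          (LieSubmodule.lie_mem_lie trivial (ih a m))
      | zero => simp
      | add y z _ _ hy hz => rw [add_lie]; exact add_mem hy hz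
      | smul c y _ hy => rw [smul_lie]; exact SMulMemClass.smul_mem c hy
  simpa [hk'] using key k x m

/-- A Casimir-type element built from dual families commutes with the action. -/
lemma commute_sum_toEnd_mul_toEnd {ι : Type*} [Fintype ι]
    (b d : ι → L) (z : L) (a : ι → ι → K)
    (hb : ∀ i, ⁅z, b i⁆ = ∑ j, a i j • b j) (hd : ∀ i, ⁅z, d i⁆ = -∑ j, a j i • d j) :
    Commute (toEnd K L E z) (∑ i, toEnd K L E (b i) * toEnd K L E (d i)) := by
  have h1 : ∀ x y : L, toEnd K L E x * toEnd K L E y =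
      toEnd K L E y * toEnd K L E x + toEnd K L E ⁅x, y⁆ := by
    intro x y
    ext m
    simp
  have h2 : ∀ i, toEnd K L E z * (toEnd K L E (b i) * toEnd K L E (d i)) =
      toEnd K L E (b i) * toEnd K L E (d i) * toEnd K L E z +
      (toEnd K L E ⁅z, b i⁆ * toEnd K L E (d i) + toEnd K L E (b i) * toEnd K L E ⁅z, d i⁆) := by
    intro i
    rw [← mul_assoc, h1 z, add_mul, mul_assoc, h1 z]
    noncomm_ring
  have h3 : ∑ i, (toEnd K L E ⁅z, b i⁆ * toEnd K L E (d i)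
      + toEnd K L E (b i) * toEnd K L E ⁅z, d i⁆) = 0 := by
    simp only [hb, hd, map_sum, map_neg, map_smul, Finset.sum_add_distrib, Finset.sum_mul,
      mul_neg, Finset.mul_sum, smul_mul_assoc, mul_smul_comm, Finset.sum_neg_distrib]
    rw [Finset.sum_comm, add_neg_cancel]
  rw [Commute, SemiconjBy, Finset.mul_sum, Finset.sum_mul, Finset.sum_congr rfl fun i _ => h2 i,
    Finset.sum_add_distrib, h3, add_zero]

/-- If the trace form is nonzero, then there is an endomorphism commuting with the action which has
nonzero trace and maps `E` into any subspace containing `⁅L, E⁆`. -/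
lemma exists_casimir [CharZero K] [FiniteDimensional K L] [LieAlgebra.IsSemisimple K L]
    [FiniteDimensional K E] (h : traceForm K L E ≠ 0) :
    ∃ c : Module.End K E, (∀ x : L, Commute (toEnd K L E x) c) ∧
      (∀ (B : Submodule K E), (∀ (x : L) (m : E), ⁅x, m⁆ ∈ B) → ∀ m, c m ∈ B) ∧
      LinearMap.trace K E c ≠ 0 := by
  classical
  obtain ⟨J, hJ⟩ := exists_isCompl (LieAlgebra.InvariantForm.orthogonal (traceForm K L E)
    (traceForm_lieInvariant K L E) (⊤ : LieIdeal K L))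
  have hsup := hJ.sup_eq_top
  have hdisj := hJ.disjoint
  have hR : ∀ y, y ∈ LieAlgebra.InvariantForm.orthogonal (traceForm K L E)
    (traceForm_lieInvariant K L E) (⊤ : LieIdeal K L) ↔ ∀ x, traceForm K L E x y = 0 := by
    intro y
    simp [LieAlgebra.InvariantForm.mem_orthogonal]
  set R := LieAlgebra.InvariantForm.orthogonal (traceForm K L E)
    (traceForm_lieInvariant K L E) (⊤ : LieIdeal K L)
  have key : ∀ x : L, ∃ j ∈ J, ∀ y, traceForm K L E x y = traceForm K L E j y := by
    intro x
    have : x ∈ R ⊔ J := hsup ▸ LieSubmodule.mem_top x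
    obtain ⟨r, hr, j, hj, rfl⟩ := (LieSubmodule.mem_sup _ _ _).1 this
    refine ⟨j, hj, fun y => ?_⟩
    rw [map_add, LinearMap.add_apply, traceForm_comm K L E r, (hR r).1 hr, zero_add]
  let B : LinearMap.BilinForm K J := (traceForm K L E).restrict J.toSubmodule
  have hBa : ∀ x y : J, B x y = traceForm K L E x y := fun _ _ => rfl
  have hsymm : B.IsSymm := ⟨fun x y => by
    simpa [hBa] using traceForm_comm K L E _ _⟩
  have hnd : B.Nondegenerate := by
    have hz : ∀ x : J, (∀ y, B x y = 0) → x = 0 := by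
      intro x hx
      have hxR : (x : L) ∈ R := (hR _).2 fun y => by
        obtain ⟨j, hj, hy⟩ := key y
        rw [hy, traceForm_comm]
        exact hx ⟨j, hj⟩
      have : (x : L) ∈ R ⊓ J := ⟨hxR, x.2⟩
      rw [hdisj.eq_bot] at this
      exact Subtype.ext ((LieSubmodule.mem_bot _).1 this)
    exact ⟨hz, fun y hy => hz y fun x => by rw [hsymm.eq]; exact hy x⟩
  let b := Module.finBasis K J
  let d := B.dualBasis hnd b
  have e1 : ∀ y : J, y = ∑ j, B y (d j) • b j := by
    intro y
    conv_lhs => rw [← b.sum_repr y]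
    refine Finset.sum_congr rfl fun j _ => ?_
    congr 1
    rw [← LinearMap.BilinForm.dualBasis_dualBasis hnd hsymm b,
      LinearMap.BilinForm.dualBasis_repr_apply]
  have e2 : ∀ y : J, y = ∑ j, B (b j) y • d j := by
    intro y
    conv_lhs => rw [← d.sum_repr y]
    refine Finset.sum_congr rfl fun j _ => ?_
    rw [LinearMap.BilinForm.dualBasis_repr_apply, hsymm.eq]
  refine ⟨∑ i, toEnd K L E (b i : L) * toEnd K L E (d i : L), fun z => ?_, ?_, ?_⟩
  · refine commute_sum_toEnd_mul_toEnd _ _ z (fun i j => traceForm K L E ⁅z, (b i : L)⁆ (d j))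
      (fun i => ?_) (fun i => ?_)
    · have := congrArg (Subtype.val) (e1 ⁅z, b i⁆)
      simpa [hBa] using this
    · have := congrArg (Subtype.val) (e2 ⁅z, d i⁆)
      rw [← Finset.sum_neg_distrib]
      simp only [(traceForm_lieInvariant K L E) z]
      simpa [hBa] using this
  · intro B hB m
    simp only [LinearMap.sum_apply, Module.End.mul_apply, toEnd_apply_apply]
    exact B.sum_mem fun i _ => hB _ _
  · have : ∀ i, LinearMap.trace K E (toEnd K L E (b i : L) * toEnd K L E (d i : L)) = 1 := by
      intro i
      have : B (b i) (d i) = 1 := by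
        rw [LinearMap.BilinForm.apply_dualBasis_right hnd hsymm, if_pos rfl]
      exact this
    rw [map_sum, Finset.sum_congr rfl fun i _ => this i]
    simp only [Finset.sum_const, Finset.card_univ, Fintype.card_fin, nsmul_eq_mul, mul_one]
    intro h0
    have hJ0 : Module.finrank K J = 0 := by exact_mod_cast h0
    refine h (LinearMap.ext₂ fun x y => ?_)
    obtain ⟨j, hj, hy⟩ := key x
    have := Module.finrank_zero_iff.1 hJ0
    have hj0 : j = 0 := congrArg Subtype.val (Subsingleton.elim (⟨j, hj⟩ : J) 0)
    rw [hy, hj0]; simp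

/-- If `⁅L, E⁆ ⊆ B`, then `E` is the sum of `B` and its invariants. -/
lemma exists_eq_add_of_lie_mem [CharZero K] [FiniteDimensional K L] [LieAlgebra.IsSemisimple K L]
    [FiniteDimensional K E] (B : LieSubmodule K L E) (hB : ∀ (x : L) (m : E), ⁅x, m⁆ ∈ B) (m : E) :
    ∃ b ∈ B, ∃ e : E, (∀ x : L, ⁅x, e⁆ = 0) ∧ m = b + e := by
  induction hn : Module.finrank K E using Nat.strong_induction_on generalizing E with
  | _ n ih =>
  by_cases h : traceForm K L E = 0
  · exact ⟨0, zero_mem _, m, fun x => lie_eq_zero_of_traceForm_eq_zero h x m, by simp⟩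
  obtain ⟨c, hc, hcB, htr⟩ := exists_casimir h
  have hnil : ¬ _root_.IsNilpotent c := fun hnil =>
    htr (LinearMap.isNilpotent_trace_of_isNilpotent hnil).eq_zero
  obtain ⟨k, hcompl, hk⟩ := ((LinearMap.eventually_isCompl_ker_pow_range_pow c).and
    (Filter.eventually_ge_atTop 1)).exists
  let N : LieSubmodule K L E :=
    { __ := LinearMap.ker (c ^ k)
      lie_mem := by
        intro x e he
        have := LinearMap.congr_fun ((hc x).pow_right k).eq e
        simp only [AddSubsemigroup.mem_carrier, AddSubmonoid.mem_toSubsemigroup,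
          Submodule.mem_toAddSubmonoid, LinearMap.mem_ker] at he ⊢
        simpa [he] using this.symm }
  have hNtop : N.toSubmodule ≠ ⊤ := fun h => hnil ⟨k, LinearMap.ker_eq_top.1 h⟩
  have hlt : Module.finrank K N < n := hn ▸ Submodule.finrank_lt hNtop
  have hm : m ∈ LinearMap.ker (c ^ k) ⊔ LinearMap.range (c ^ k) :=
    hcompl.sup_eq_top ▸ Submodule.mem_top
  obtain ⟨p, hp, q, ⟨r, rfl⟩, rfl⟩ := Submodule.mem_sup.1 hm
  have hq : (c ^ k) r ∈ B := by
    obtain ⟨j, rfl⟩ := Nat.exists_eq_add_of_le' hk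
    rw [pow_succ', Module.End.mul_apply]
    exact hcB B.toSubmodule hB _
  obtain ⟨b, hb, e, he, hpe⟩ := ih _ hlt (B.comap N.incl) (fun x y => hB x y) (⟨p, hp⟩ : N) rfl
  refine ⟨b + (c ^ k) r, add_mem hb hq, e, fun x => congrArg Subtype.val (he x), ?_⟩
  have : p = b + e := congrArg Subtype.val hpe
  rw [this]; abel

/-- **Weyl's theorem** on complete reducibility. -/
theorem exists_isCompl_of_isSemisimple [CharZero K] [FiniteDimensional K L]
    [LieAlgebra.IsSemisimple K L] [FiniteDimensional K E] (N : LieSubmodule K L E) :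
    ∃ N' : LieSubmodule K L E, IsCompl N N' := by
  let A : LieSubmodule K L (E →ₗ[K] N) :=
    { carrier := {φ | ∃ a : K, ∀ n : N, φ n = a • n}
      add_mem' := by
        rintro φ ψ ⟨a, ha⟩ ⟨b, hb⟩
        exact ⟨a + b, fun n => by simp [ha, hb, add_smul]⟩
      zero_mem' := ⟨0, by simp⟩
      smul_mem' := by
        rintro t φ ⟨a, ha⟩
        exact ⟨t * a, fun n => by simp [ha, mul_smul]⟩
      lie_mem := by
        rintro x φ ⟨a, ha⟩
        refine ⟨0, fun n => ?_⟩
        have := ha ⁅x, n⁆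
        rw [LieSubmodule.coe_bracket] at this
        rw [LieHom.lie_apply, ha, this]
        simp }
  have hA : ∀ (x : L) (φ : A) (n : N), (⁅x, φ⁆ : A).1 n = 0 := by
    rintro x ⟨φ, a, ha⟩ n
    have := ha ⁅x, n⁆
    rw [LieSubmodule.coe_bracket] at this
    rw [LieSubmodule.coe_bracket, LieHom.lie_apply, ha, this]
    simp
  let B : LieSubmodule K L A :=
    { carrier := {φ | ∀ n : N, φ.1 n = 0}
      add_mem' := by
        intro φ ψ h1 h2 n
        simp [h1 n, h2 n]
      zero_mem' := by intro n; rfl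
      smul_mem' := by
        intro t φ h n
        simp [h n]
      lie_mem := by
        intro x φ h
        exact hA x φ }
  obtain ⟨π, hπ⟩ := N.toSubmodule.subtype.exists_leftInverse_of_injective
    N.toSubmodule.ker_subtype
  have hπ' : ∀ n : N, π n = n := fun n => LinearMap.congr_fun hπ n
  obtain ⟨b, hb, e, he, hbe⟩ := exists_eq_add_of_lie_mem B hA
    ⟨π, 1, fun n => by rw [hπ', one_smul]⟩
  have hen : ∀ n : N, e.1 n = n := by
    intro n
    have h1 : π n = b.1 n + e.1 n := congrArg (fun f : A => f.1 n) hbe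
    rw [hb n, zero_add, hπ'] at h1
    exact h1.symm
  have hlie : ∀ (x : L) (m : E), e.1 ⁅x, m⁆ = ⁅x, e.1 m⁆ := by
    intro x m
    have := congrArg (fun f : A => f.1 m) (he x)
    simp only [LieSubmodule.coe_bracket, LieHom.lie_apply] at this
    exact (sub_eq_zero.1 this).symm
  refine ⟨{ __ := LinearMap.ker e.1
            lie_mem := by
              intro x m hm
              simp only [AddSubsemigroup.mem_carrier, AddSubmonoid.mem_toSubsemigroup,
                Submodule.mem_toAddSubmonoid, LinearMap.mem_ker] at hm ⊢
              rw [hlie, hm, lie_zero] }, ?_⟩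
  rw [← LieSubmodule.isCompl_toSubmodule]
  exact LinearMap.isCompl_of_proj hen

end LieModule

lemma LieModule.isIrreducible_iff_isAtom {K 𝔤 M : Type*} [CommRing K] [LieRing 𝔤] [AddCommGroup M]
    [Module K M] [LieRingModule 𝔤 M] {S : LieSubmodule K 𝔤 M} :
    LieModule.IsIrreducible K 𝔤 S ↔ IsAtom S := by
  let f := LieSubmodule.mapOrderEmbedding (f := S.incl) Subtype.coe_injective
  constructor
  · intro h
    refine ⟨(LieSubmodule.nontrivial_iff_ne_bot K 𝔤 M).1
      ((LieSubmodule.nontrivial_iff K 𝔤 S).1 inferInstance), fun N hN => ?_⟩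
    rcases IsSimpleOrder.eq_bot_or_eq_top (N.comap S.incl) with h | h
    · rwa [LieSubmodule.comap_incl_eq_bot, inf_eq_right.2 hN.le] at h
    · exact absurd (LieSubmodule.comap_incl_eq_top.1 h) hN.not_ge
  · intro h
    have : Nontrivial S := (LieSubmodule.nontrivial_iff_ne_bot K 𝔤 M).2 h.1
    refine LieModule.IsIrreducible.mk fun N hN => ?_
    by_contra hN'
    refine hN (f.injective ?_)
    have := h.2 _ (LieSubmodule.map_incl_lt_iff_lt_top.2 (lt_top_iff_ne_top.2 hN'))
    exact this.trans LieSubmodule.map_bot.symm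


section HighestWeight

variable {K : Type*} [Field K] {𝔤 : Type*} [LieRing 𝔤] [LieAlgebra K 𝔤] {H : LieSubalgebra K 𝔤}

/-- The space of vectors of weight `μ` killed by all the root spaces `𝔤_α` with `α ∈ Δ`. -/
def highestWeightSpace (Δ : Finset (Module.Dual K H)) (M : Type*) [AddCommGroup M] [Module K M]
    [LieRingModule 𝔤 M] [LieModule K 𝔤 M] (μ : Module.Dual K H) : Submodule K M where
  carrier := {v | v ∈ hWeightSpace K 𝔤 H M μ ∧ ∀ α ∈ Δ, ∀ e ∈ hRootSpace K 𝔤 H α, ⁅e, v⁆ = 0}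
  add_mem' := by
    rintro a b ⟨ha, ha'⟩ ⟨hb, hb'⟩
    exact ⟨add_mem ha hb, fun α hα e he => by rw [lie_add, ha' α hα e he, hb' α hα e he, add_zero]⟩
  zero_mem' := ⟨zero_mem _, fun _ _ _ _ => lie_zero _⟩
  smul_mem' := by
    rintro c a ⟨ha, ha'⟩
    exact ⟨Submodule.smul_mem _ c ha, fun α hα e he => by rw [lie_smul, ha' α hα e he, smul_zero]⟩

variable {Δ : Finset (Module.Dual K H)} {M : Type*} [AddCommGroup M] [Module K M]
  [LieRingModule 𝔤 M] [LieModule K 𝔤 M] {μ ν : Module.Dual K H}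

lemma lie_mem_hWeightSpace {x : 𝔤} {v : M} (hx : x ∈ hRootSpace K 𝔤 H μ)
    (hv : v ∈ hWeightSpace K 𝔤 H M ν) : ⁅x, v⁆ ∈ hWeightSpace K 𝔤 H M (μ + ν) := by
  intro h
  rw [leibniz_lie, hx h, hv h, smul_lie, lie_smul, LinearMap.add_apply, add_smul]

lemma coe_mem_highestWeightSpace (N : LieSubmodule K 𝔤 M) (v : N) :
    (v : M) ∈ highestWeightSpace Δ M μ ↔ v ∈ highestWeightSpace Δ N μ := by
  constructor
  · rintro ⟨h1, h2⟩
    exact ⟨fun h => Subtype.ext (h1 h), fun α hα e he => Subtype.ext (h2 α hα e he)⟩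
  · rintro ⟨h1, h2⟩
    exact ⟨fun h => congrArg Subtype.val (h1 h),
      fun α hα e he => congrArg Subtype.val (h2 α hα e he)⟩

/-- The components of a highest weight vector along a direct sum are highest weight vectors. -/
lemma mem_highestWeightSpace_of_add_mem {A B : LieSubmodule K 𝔤 M} (hAB : Disjoint A B) {a b : M}
    (ha : a ∈ A) (hb : b ∈ B) (hab : a + b ∈ highestWeightSpace Δ M μ) :
    a ∈ highestWeightSpace Δ M μ ∧ b ∈ highestWeightSpace Δ M μ := by
  have key : ∀ x ∈ A, ∀ y ∈ B, x + y = 0 → x = 0 ∧ y = 0 := by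
    intro x hx y hy hxy
    have hx0 : x = 0 := by
      have : x ∈ A ⊓ B := ⟨hx, by rw [eq_neg_of_add_eq_zero_left hxy]; exact neg_mem hy⟩
      rwa [hAB.eq_bot, LieSubmodule.mem_bot] at this
    exact ⟨hx0, by rwa [hx0, zero_add] at hxy⟩
  have h1 : ∀ h : H, ⁅(h : 𝔤), a⁆ - μ h • a = 0 ∧ ⁅(h : 𝔤), b⁆ - μ h • b = 0 := fun h =>
    key _ (sub_mem (A.lie_mem ha) (SMulMemClass.smul_mem _ ha)) _
      (sub_mem (B.lie_mem hb) (SMulMemClass.smul_mem _ hb)) (by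
        have := hab.1 h
        rw [lie_add, smul_add] at this
        rw [sub_add_sub_comm, this, sub_self])
  have h2 : ∀ α ∈ Δ, ∀ e ∈ hRootSpace K 𝔤 H α, ⁅e, a⁆ = 0 ∧ ⁅e, b⁆ = 0 := fun α hα e he =>
    key _ (A.lie_mem ha) _ (B.lie_mem hb) (by rw [← lie_add]; exact hab.2 α hα e he)
  exact ⟨⟨fun h => sub_eq_zero.1 (h1 h).1, fun α hα e he => (h2 α hα e he).1⟩,
    ⟨fun h => sub_eq_zero.1 (h1 h).2, fun α hα e he => (h2 α hα e he).2⟩⟩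

/-- A family of irreducible submodules is independent as soon as the highest weights occurring in
them are separated by an element `h` of the Cartan subalgebra. -/
lemma iSupIndep_of_highestWeight_apply_injective {ι : Type*} [Finite ι]
    {W : ι → LieSubmodule K 𝔤 M} [∀ i, LieModule.IsIrreducible K 𝔤 (W i)]
    {χ : ι → Module.Dual K H} (h : H) (hχ : Function.Injective fun i => χ i h)
    (hW : ∀ i, ∃ v ∈ W i, IsHighestWeightVector K 𝔤 H Δ M (χ i) v)
    (huniq : ∀ i, ∀ v ∈ W i, ∀ ν, IsHighestWeightVector K 𝔤 H Δ M ν v → ν h = χ i h) :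
    iSupIndep W := by
  classical
  have key : ∀ (s : Finset ι) (v : M) (ν : Module.Dual K H), v ∈ s.sup W →
      IsHighestWeightVector K 𝔤 H Δ M ν v → ∃ j ∈ s, ν h = χ j h := by
    intro s
    induction s using Finset.induction_on with
    | empty =>
      intro v ν hv hν
      exact absurd ((LieSubmodule.mem_bot _).1 hv) hν.1
    | insert j s _ ih =>
      intro v ν hv hν
      rw [Finset.sup_insert] at hv
      have hatom : IsAtom (W j) := LieModule.isIrreducible_iff_isAtom.1 inferInstance
      rcases hatom.le_iff.1 (inf_le_left : W j ⊓ s.sup W ≤ W j) with hd | hd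
      · obtain ⟨a, ha, b, hb, rfl⟩ := (LieSubmodule.mem_sup _ _ _).1 hv
        obtain ⟨ha', hb'⟩ := mem_highestWeightSpace_of_add_mem (disjoint_iff.2 hd) ha hb hν.2
        by_cases ha0 : a = 0
        · obtain ⟨k, hk, hk'⟩ := ih b ν hb ⟨by simpa [ha0] using hν.1, hb'⟩
          exact ⟨k, Finset.mem_insert_of_mem hk, hk'⟩
        · exact ⟨j, Finset.mem_insert_self _ _, huniq j a ha ν ⟨ha0, ha'⟩⟩
      · rw [sup_eq_right.2 (inf_eq_left.1 hd)] at hv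
        obtain ⟨k, hk, hk'⟩ := ih v ν hv hν
        exact ⟨k, Finset.mem_insert_of_mem hk, hk'⟩
  have := Fintype.ofFinite ι
  rw [iSupIndep_def]
  intro i
  have hatom : IsAtom (W i) := LieModule.isIrreducible_iff_isAtom.1 inferInstance
  rw [← hatom.not_le_iff_disjoint]
  intro hle
  have hle' : W i ≤ (Finset.univ.erase i).sup W := hle.trans <| iSup₂_le fun j hj =>
    Finset.le_sup (f := W) (by simpa using hj)
  obtain ⟨v, hv, hv'⟩ := hW i
  obtain ⟨j, hj, hj'⟩ := key _ v _ (hle' hv) hv'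
  exact (Finset.mem_erase.1 hj).1 (hχ hj').symm

variable [CharZero K] [FiniteDimensional K 𝔤] [LieAlgebra.IsSemisimple K 𝔤]
  [FiniteDimensional K M]

/-- Every highest weight occurring in a finite-dimensional module is the highest weight of an
irreducible submodule. -/
lemma exists_isIrreducible_highestWeightVector {u : M}
    (hu : IsHighestWeightVector K 𝔤 H Δ M μ u) :
    ∃ S : LieSubmodule K 𝔤 M, LieModule.IsIrreducible K 𝔤 S ∧
      ∃ v ∈ S, IsHighestWeightVector K 𝔤 H Δ M μ v := by
  have := LieSubmodule.wellFoundedLT_of_isArtinian K 𝔤 M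
  obtain ⟨S, ⟨u, huS, hu0, hu⟩, hmin⟩ := exists_minimal_of_wellFoundedLT
    (fun S : LieSubmodule K 𝔤 M => ∃ v ∈ S, v ≠ 0 ∧ v ∈ highestWeightSpace Δ M μ)
    ⟨⊤, u, LieSubmodule.mem_top u, hu.1, hu.2⟩
  refine ⟨S, LieModule.isIrreducible_iff_isAtom.2 ⟨?_, fun N hN => ?_⟩, u, huS, hu0, hu⟩
  · rintro rfl
    exact hu0 ((LieSubmodule.mem_bot _).1 huS)
  · obtain ⟨N', hN'⟩ := LieModule.exists_isCompl_of_isSemisimple N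
    have hmem : u ∈ N ⊔ N' := hN'.sup_eq_top ▸ LieSubmodule.mem_top u
    obtain ⟨a, ha, b, hb, rfl⟩ := (LieSubmodule.mem_sup _ _ _).1 hmem
    obtain ⟨ha', hb'⟩ := mem_highestWeightSpace_of_add_mem hN'.disjoint ha hb hu
    by_contra hNbot
    have hbS : b ∈ S := by simpa using sub_mem huS (hN.le ha)
    have hNS : ¬ S ≤ N := hN.not_ge
    have hN'S : ¬ S ≤ N' ⊓ S := fun h => hNbot <| eq_bot_iff.2 <|
      hN'.inf_eq_bot ▸ le_inf le_rfl (hN.le.trans (h.trans inf_le_left))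
    by_cases ha0 : a = 0
    · exact hN'S (hmin ⟨b, ⟨hb, hbS⟩, by simpa [ha0] using hu0, hb'⟩ inf_le_right)
    · exact hNS (hmin ⟨a, ha, ha0, ha'⟩ hN.le)

end HighestWeight

section Roots

open LieAlgebra LieModule

variable {K : Type*} [Field K] {𝔤 : Type*} [LieRing 𝔤] [LieAlgebra K 𝔤] {H : LieSubalgebra K 𝔤}
  {α γ : Module.Dual K H}

lemma isLieRoot_of_mem {x : 𝔤} (hγ : γ ≠ 0) (hx : x ∈ hRootSpace K 𝔤 H γ) (hx0 : x ≠ 0) :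
    IsLieRoot K 𝔤 H γ :=
  ⟨hγ, fun h => hx0 (by rwa [h, Submodule.mem_bot] at hx)⟩

/-- The coroot of a root, together with root vectors, forms an `sl₂`-triple. -/
lemma IsCoroot.exists_isSl2Triple [CharZero K] {h : H} (hh : IsCoroot K 𝔤 H γ h) :
    ∃ e ∈ hRootSpace K 𝔤 H γ, ∃ f ∈ hRootSpace K 𝔤 H (-γ), IsSl2Triple (h : 𝔤) e f := by
  obtain ⟨h2, e, he, f, hf, hef⟩ := hh
  refine ⟨e, he, f, hf, ⟨?_, hef, ?_, ?_⟩⟩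
  · intro h0
    have : h = 0 := Subtype.ext h0
    simp [this] at h2
  · rw [he h, h2, two_smul, two_nsmul]
  · rw [hf h, LinearMap.neg_apply, h2, neg_smul, two_smul, two_nsmul]

variable [IsAlgClosed K] [CharZero K] [FiniteDimensional K 𝔤] [LieAlgebra.IsSemisimple K 𝔤]
  [H.IsCartanSubalgebra]

lemma mem_hRootSpace_iff_mem_rootSpace {x : 𝔤} :
    x ∈ hRootSpace K 𝔤 H γ ↔ x ∈ rootSpace H (γ : H → K) := by
  constructor
  · intro hx
    rw [mem_genWeightSpace]
    exact fun h => ⟨1, by simpa [sub_eq_zero] using hx h⟩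
  · exact fun hx h => IsKilling.lie_eq_smul_of_mem_rootSpace hx h

lemma iSup_hRootSpace_eq_top : ⨆ γ : Module.Dual K H, hRootSpace K 𝔤 H γ = ⊤ := by
  have h := iSup_genWeightSpace_eq_top' K H 𝔤
  rw [← LieSubmodule.toSubmodule_inj, LieSubmodule.iSup_toSubmodule,
    LieSubmodule.top_toSubmodule] at h
  rw [eq_top_iff, ← h]
  refine iSup_le fun χ => le_iSup_of_le χ.toLinear fun x hx => ?_
  exact mem_hRootSpace_iff_mem_rootSpace.2 hx

lemma exists_killingForm_ne_zero {x : 𝔤} (hx : x ∈ hRootSpace K 𝔤 H γ) (hx0 : x ≠ 0) :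
    ∃ y ∈ hRootSpace K 𝔤 H (-γ), killingForm K 𝔤 x y ≠ 0 := by
  by_contra! h
  refine hx0 ?_
  simpa using mem_ker_killingForm_of_mem_rootSpace_of_forall_rootSpace_neg K 𝔤 H
    (mem_hRootSpace_iff_mem_rootSpace.1 hx)
    fun y hy => h y (mem_hRootSpace_iff_mem_rootSpace.2 hy)

lemma IsLieRoot.neg (hγ : IsLieRoot K 𝔤 H γ) : IsLieRoot K 𝔤 H (-γ) := by
  obtain ⟨x, hx, hx0⟩ := Submodule.exists_mem_ne_zero_of_ne_bot hγ.2
  obtain ⟨y, hy, hxy⟩ := exists_killingForm_ne_zero hx hx0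
  exact isLieRoot_of_mem (neg_ne_zero.2 hγ.1) hy fun h => hxy (by simp [h])

/-- A root, as a weight of the adjoint module. -/
lemma IsLieRoot.exists_weight (hγ : IsLieRoot K 𝔤 H γ) :
    ∃ χ : Weight K H 𝔤, χ.IsNonZero ∧ (χ : H → K) = γ := by
  obtain ⟨x, hx, hx0⟩ := Submodule.exists_mem_ne_zero_of_ne_bot hγ.2
  refine ⟨⟨γ, fun h => hx0 ?_⟩, fun h => hγ.1 (DFunLike.coe_injective h), rfl⟩
  have := mem_hRootSpace_iff_mem_rootSpace.1 hx
  rw [rootSpace, h] at this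
  simpa using this

lemma IsLieRoot.exists_isSl2Triple (hγ : IsLieRoot K 𝔤 H γ) :
    ∃ (h : H) (e f : 𝔤), IsSl2Triple (h : 𝔤) e f ∧ e ∈ hRootSpace K 𝔤 H γ ∧
      f ∈ hRootSpace K 𝔤 H (-γ) ∧ γ h = 2 := by
  obtain ⟨χ, hχ, hχγ⟩ := hγ.exists_weight
  obtain ⟨h, e, f, ht, he, hf⟩ := IsKilling.exists_isSl2Triple_of_weight_isNonZero hχ
  have hh := ht.h_eq_coroot hχ he hf
  refine ⟨IsKilling.coroot χ, e, f, hh ▸ ht, mem_hRootSpace_iff_mem_rootSpace.2 (hχγ ▸ he),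
    mem_hRootSpace_iff_mem_rootSpace.2 (by rw [LinearMap.coe_neg, ← hχγ]; exact hf), ?_⟩
  rw [← hχγ, IsKilling.root_apply_coroot hχ]

lemma IsLieRoot.exists_eq_smul (hγ : IsLieRoot K 𝔤 H γ) {x y : 𝔤} (hx : x ∈ hRootSpace K 𝔤 H γ)
    (hx0 : x ≠ 0) (hy : y ∈ hRootSpace K 𝔤 H γ) : ∃ c : K, y = c • x := by
  obtain ⟨χ, hχ, hχγ⟩ := hγ.exists_weight
  rw [mem_hRootSpace_iff_mem_rootSpace, ← hχγ] at hx hy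
  obtain ⟨c, hc⟩ := (finrank_eq_one_iff_of_nonzero' (⟨x, hx⟩ : rootSpace H χ)
    (by simpa [LieSubmodule.mk_eq_zero] using hx0)).1 (IsKilling.finrank_rootSpace_eq_one χ hχ)
    ⟨y, hy⟩
  exact ⟨c, (congrArg Subtype.val hc).symm⟩

end Roots

section RootBase

open LieAlgebra LieModule

variable {K : Type*} [Field K] {𝔤 : Type*} [LieRing 𝔤] [LieAlgebra K 𝔤] {H : LieSubalgebra K 𝔤}
  {Δ : Finset (Module.Dual K H)} {α β γ : Module.Dual K H}

lemma IsRootBase.exists_nat_coeff (hΔ : IsRootBase K 𝔤 H Δ) (hγ : IsLieRoot K 𝔤 H γ) :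
    ∃ c : Module.Dual K H → ℕ, γ = ∑ β ∈ Δ, c β • β ∨ γ = -∑ β ∈ Δ, c β • β := by
  obtain ⟨c, rfl, hc | hc⟩ := hΔ.2.2 γ hγ
  · refine ⟨fun β => (c β).toNat, .inl (Finset.sum_congr rfl fun β hβ => ?_)⟩
    rw [← natCast_zsmul, Int.toNat_of_nonneg (hc β hβ)]
  · refine ⟨fun β => (-c β).toNat, .inr ?_⟩
    rw [← Finset.sum_neg_distrib]
    refine Finset.sum_congr rfl fun β hβ => ?_
    rw [← natCast_zsmul, Int.toNat_of_nonneg (neg_nonneg.2 (hc β hβ)), neg_smul, neg_neg]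

/-- There is an element of the Cartan subalgebra on which every root takes its height. -/
lemma IsRootBase.exists_apply_eq_one [FiniteDimensional K 𝔤] (hΔ : IsRootBase K 𝔤 H Δ) :
    ∃ h₀ : H, ∀ β ∈ Δ, β h₀ = 1 := by
  let b := Module.Basis.extend (s := (Δ : Set (Module.Dual K H))) hΔ.2.1
  obtain ⟨h₀, hh₀⟩ := (Module.evalEquiv K H).surjective (b.constr K fun _ => (1 : K))
  refine ⟨h₀, fun β hβ => ?_⟩
  have hb : b ⟨β, Module.Basis.subset_extend (s := (Δ : Set (Module.Dual K H))) hΔ.2.1 hβ⟩ = β :=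
    Module.Basis.extend_apply_self (s := (Δ : Set (Module.Dual K H))) hΔ.2.1 _
  have h := b.constr_basis K (fun _ => (1 : K)) ⟨β, Module.Basis.subset_extend _ hβ⟩
  rwa [hb, ← hh₀] at h

variable {h₀ : H}

lemma sum_nsmul_apply_eq (hh₀ : ∀ β ∈ Δ, β h₀ = 1) (c : Module.Dual K H → ℕ) :
    (∑ β ∈ Δ, c β • β) h₀ = ((∑ β ∈ Δ, c β : ℕ) : K) := by
  rw [LinearMap.sum_apply, Nat.cast_sum]
  exact Finset.sum_congr rfl fun β hβ => by simp [hh₀ β hβ]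

/-- The height of a root is a nonzero integer. -/
lemma IsRootBase.exists_apply_eq (hΔ : IsRootBase K 𝔤 H Δ) (hh₀ : ∀ β ∈ Δ, β h₀ = 1)
    (hγ : IsLieRoot K 𝔤 H γ) : ∃ n : ℕ, n ≠ 0 ∧ (γ h₀ = n ∨ γ h₀ = -n) := by
  obtain ⟨c, hc⟩ := hΔ.exists_nat_coeff hγ
  refine ⟨∑ β ∈ Δ, c β, fun h => hγ.1 ?_, ?_⟩
  · have h0 : ∑ β ∈ Δ, c β • β = 0 :=
      Finset.sum_eq_zero fun β hβ => by rw [Finset.sum_eq_zero_iff.1 h β hβ, zero_smul]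
    rcases hc with rfl | rfl <;> simp [h0]
  · rw [← sum_nsmul_apply_eq hh₀]
    exact hc.imp (fun h => by rw [h]) fun h => by rw [h, LinearMap.neg_apply]

/-- The difference of two simple roots is not a root. -/
lemma IsRootBase.eq_zero_of_mem_hRootSpace_sub [CharZero K] [FiniteDimensional K 𝔤]
    (hΔ : IsRootBase K 𝔤 H Δ) (hα : α ∈ Δ) (hβ : β ∈ Δ) (hαβ : α ≠ β) {x : 𝔤}
    (hx : x ∈ hRootSpace K 𝔤 H (α - β)) : x = 0 := by
  obtain ⟨h₀, hh₀⟩ := hΔ.exists_apply_eq_one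
  by_contra hx0
  obtain ⟨n, hn, h⟩ := hΔ.exists_apply_eq hh₀ (isLieRoot_of_mem (sub_ne_zero.2 hαβ) hx hx0)
  rw [LinearMap.sub_apply, hh₀ α hα, hh₀ β hβ, sub_self] at h
  rcases h with h | h
  · exact hn (by exact_mod_cast h.symm)
  · exact hn (by exact_mod_cast zero_eq_neg.1 h)

/-- A negative root vector of a non-simple positive root does not commute with all the simple root
vectors. -/
lemma IsRootBase.exists_lie_ne_zero [CharZero K] [FiniteDimensional K 𝔤]
    (hΔ : IsRootBase K 𝔤 H Δ) {c : Module.Dual K H → ℕ} (hγ : γ = ∑ β ∈ Δ, c β • β)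
    {h : H} {e f : 𝔤} (ht : IsSl2Triple (h : 𝔤) e f)
    (h2 : γ h = 2) : ∃ β ∈ Δ, ∃ x ∈ hRootSpace K 𝔤 H β, ⁅f, x⁆ ≠ 0 := by
  by_contra! hcon
  have key : ∀ β ∈ Δ, ∃ k : ℕ, -β h = k := by
    intro β hβ
    obtain ⟨x, hx, hx0⟩ := Submodule.exists_mem_ne_zero_of_ne_bot (hΔ.1 β hβ).2
    have P : ht.symm.HasPrimitiveVectorWith x (-β h) :=
      ⟨hx0, by rw [neg_lie, hx h, neg_smul], hcon β hβ x hx⟩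
    exact P.exists_nat
  choose! k hk using key
  have hsum : γ h + ((∑ β ∈ Δ, c β * k β : ℕ) : K) = 0 := by
    rw [hγ, LinearMap.sum_apply, Nat.cast_sum, ← Finset.sum_add_distrib]
    exact Finset.sum_eq_zero fun β hβ => by
      rw [Nat.cast_mul, ← hk β hβ, LinearMap.smul_apply, nsmul_eq_mul]; ring
  rw [h2] at hsum
  have : 2 + ∑ β ∈ Δ, c β * k β = 0 := by exact_mod_cast hsum
  omega

variable [IsAlgClosed K] [CharZero K] [FiniteDimensional K 𝔤] [LieAlgebra.IsSemisimple K 𝔤]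
  [H.IsCartanSubalgebra] {M : Type*} [AddCommGroup M] [Module K M] [LieRingModule 𝔤 M]
  [LieModule K 𝔤 M] {μ ν : Module.Dual K H}

/-- A vector killed by the simple root spaces is killed by all the positive root spaces. -/
lemma IsRootBase.lie_eq_zero_of_pos (hΔ : IsRootBase K 𝔤 H Δ) (hh₀ : ∀ β ∈ Δ, β h₀ = 1) {v : M}
    (hv : ∀ β ∈ Δ, ∀ e ∈ hRootSpace K 𝔤 H β, ⁅e, v⁆ = 0) (n : ℕ) (hγ : IsLieRoot K 𝔤 H γ)
    (hn : γ h₀ = n) {x : 𝔤} (hx : x ∈ hRootSpace K 𝔤 H γ) : ⁅x, v⁆ = 0 := by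
  induction n generalizing γ x with
  | zero =>
    obtain ⟨m, hm, h⟩ := hΔ.exists_apply_eq hh₀ hγ
    rw [hn] at h
    rcases h with h | h
    · exact absurd (by exact_mod_cast h.symm) hm
    · exact absurd (by simpa using h) hm
  | succ n ih =>
    by_cases hγΔ : γ ∈ Δ
    · exact hv γ hγΔ x hx
    obtain ⟨c, hc⟩ := hΔ.exists_nat_coeff hγ
    have hc : γ = ∑ β ∈ Δ, c β • β := hc.resolve_right fun h => by
      rw [h, LinearMap.neg_apply, sum_nsmul_apply_eq hh₀, neg_eq_iff_add_eq_zero] at hn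
      norm_cast at hn
    obtain ⟨h, e, f, ht, he, hf, h2⟩ := hγ.exists_isSl2Triple
    obtain ⟨β, hβ, x', hx', hfx⟩ := hΔ.exists_lie_ne_zero hc ht h2
    have hmem := lie_mem_hWeightSpace hf hx'
    have hroot : IsLieRoot K 𝔤 H (-γ + β) := isLieRoot_of_mem
      (fun h => hγΔ (by rwa [neg_add_eq_zero.1 h])) hmem hfx
    obtain ⟨y, hy, hκ⟩ := exists_killingForm_ne_zero hmem hfx
    rw [traceForm_apply_lie_apply] at hκ
    have hxy0 : ⁅x', y⁆ ≠ 0 := fun h => hκ (by rw [h, map_zero])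
    have hxy : ⁅x', y⁆ ∈ hRootSpace K 𝔤 H γ := by
      have := lie_mem_hWeightSpace hx' hy
      rwa [show β + -(-γ + β) = γ by abel] at this
    obtain ⟨t, rfl⟩ := hγ.exists_eq_smul hxy hxy0 hx
    have hyv : ⁅y, v⁆ = 0 := ih hroot.neg (by simp [hn, hh₀ β hβ]) hy
    rw [smul_lie, lie_lie, hyv, hv β hβ x' hx', lie_zero, lie_zero, sub_zero, smul_zero]

/-- The weights of an irreducible module are lower than its highest weight. -/
lemma IsRootBase.iSup_eigenspace_eq_top [LieModule.IsIrreducible K 𝔤 M]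
    (hΔ : IsRootBase K 𝔤 H Δ) (hh₀ : ∀ β ∈ Δ, β h₀ = 1) {v : M}
    (hv : IsHighestWeightVector K 𝔤 H Δ M μ v) :
    ⨆ k : ℕ, (toEnd K 𝔤 M h₀).eigenspace (μ h₀ - k) = ⊤ := by
  let S : Set 𝔤 := {x | ∃ (γ : Module.Dual K H) (n : ℕ), γ h₀ = -n ∧ x ∈ hRootSpace K 𝔤 H γ}
  let D : Submodule K M := sInf {P | v ∈ P ∧ ∀ x ∈ S, ∀ p ∈ P, ⁅x, p⁆ ∈ P}
  have hvD : v ∈ D := Submodule.mem_sInf.2 fun P hP => hP.1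
  have hSD : ∀ x ∈ S, ∀ p ∈ D, ⁅x, p⁆ ∈ D := fun x hx p hp =>
    Submodule.mem_sInf.2 fun P hP => hP.2 x hx p (Submodule.mem_sInf.1 hp P hP)
  let Q : Submodule K M :=
    D ⊓ ⨅ x : 𝔤, D.comap (toEnd K 𝔤 M x)
  have memQ : ∀ p, p ∈ Q ↔ p ∈ D ∧ ∀ x : 𝔤, ⁅x, p⁆ ∈ D := fun p => by simp [Q]
  have hvx : ∀ x : 𝔤, ⁅x, v⁆ ∈ D := by
    intro x
    have hx : x ∈ ⨆ γ : Module.Dual K H, hRootSpace K 𝔤 H γ := by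
      rw [iSup_hRootSpace_eq_top]; trivial
    induction hx using Submodule.iSup_induction' with
    | zero => rw [zero_lie]; exact zero_mem _
    | add x y _ _ hx hy => rw [add_lie]; exact add_mem hx hy
    | mem γ x hx =>
      by_cases hx0 : x = 0
      · rw [hx0, zero_lie]; exact zero_mem _
      by_cases hγ0 : γ = 0
      · exact hSD x ⟨γ, 0, by simp [hγ0], hx⟩ v hvD
      have hγ := isLieRoot_of_mem hγ0 hx hx0
      obtain ⟨n, -, hn | hn⟩ := hΔ.exists_apply_eq hh₀ hγ
      · rw [hΔ.lie_eq_zero_of_pos hh₀ hv.2.2 n hγ hn hx]; exact zero_mem _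
      · exact hSD x ⟨γ, n, hn, hx⟩ v hvD
  have hDQ : D ≤ Q := sInf_le ⟨(memQ v).2 ⟨hvD, hvx⟩, fun x hx p hp => by
    rw [memQ] at hp ⊢
    refine ⟨hp.2 x, fun y => ?_⟩
    rw [leibniz_lie]
    exact add_mem (hp.2 _) (hSD x hx _ (hp.2 y))⟩
  let D' : LieSubmodule K 𝔤 M := { D with lie_mem := fun {x m} hm => ((memQ m).1 (hDQ hm)).2 x }
  have hD' : D' = ⊤ := (IsSimpleOrder.eq_bot_or_eq_top D').resolve_left fun h =>
    hv.1 ((LieSubmodule.mem_bot v).1 (h ▸ (show v ∈ D' from hvD)))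
  have hD : D = ⊤ := congrArg LieSubmodule.toSubmodule hD'
  rw [eq_top_iff, ← hD]
  refine sInf_le ⟨Submodule.mem_iSup_of_mem 0 ?_, ?_⟩
  · rw [Module.End.mem_eigenspace_iff]
    simpa using hv.2.1 h₀
  · rintro x ⟨γ, n, hn, hx⟩ p hp
    induction hp using Submodule.iSup_induction' with
    | zero => rw [lie_zero]; exact zero_mem _
    | add p q _ _ hp hq => rw [lie_add]; exact add_mem hp hq
    | mem k p hp =>
      refine Submodule.mem_iSup_of_mem (n + k) ?_
      rw [Module.End.mem_eigenspace_iff, toEnd_apply_apply] at hp ⊢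
      rw [leibniz_lie, hx h₀, hp, smul_lie, lie_smul, ← add_smul, hn]
      congr 1
      push_cast
      ring

/-- The highest weight of an irreducible module takes a unique value on `h₀`. -/
lemma IsRootBase.highestWeight_apply_eq [LieModule.IsIrreducible K 𝔤 M]
    (hΔ : IsRootBase K 𝔤 H Δ) (hh₀ : ∀ β ∈ Δ, β h₀ = 1) {v w : M}
    (hv : IsHighestWeightVector K 𝔤 H Δ M μ v) (hw : IsHighestWeightVector K 𝔤 H Δ M ν w) :
    ν h₀ = μ h₀ := by
  have key : ∀ (μ ν : Module.Dual K H) (v w : M), IsHighestWeightVector K 𝔤 H Δ M μ v →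
      IsHighestWeightVector K 𝔤 H Δ M ν w → ∃ k : ℕ, ν h₀ = μ h₀ - k := by
    intro μ ν v w hv hw
    by_contra! hk
    have hind := (toEnd K 𝔤 M h₀).eigenspaces_iSupIndep (ν h₀)
    refine hw.1 ((Submodule.disjoint_def.1 hind) w ?_ ?_)
    · rw [Module.End.mem_eigenspace_iff]
      exact hw.2.1 h₀
    · refine (iSup_le fun k => ?_ : ⨆ k : ℕ, (toEnd K 𝔤 M h₀).eigenspace (μ h₀ - k) ≤ _)
        (hΔ.iSup_eigenspace_eq_top hh₀ hv ▸ Submodule.mem_top)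
      exact le_iSup₂_of_le (μ h₀ - k) (hk k).symm le_rfl
  obtain ⟨k, hk⟩ := key μ ν v w hv hw
  obtain ⟨l, hl⟩ := key ν μ w v hw hv
  have h : (k : K) + l = 0 := by linear_combination hk + hl
  have hk0 : k = 0 := by
    have : k + l = 0 := by exact_mod_cast h
    omega
  rw [hk, hk0, Nat.cast_zero, sub_zero]

end RootBase

section TensorSquare

open LieAlgebra LieModule
open Finset.HasAntidiagonal (antidiagonal mem_antidiagonal)

section

variable {R L M : Type*} [CommRing R] [LieRing L] [LieAlgebra R L] [AddCommGroup M] [Module R M]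
  [LieRingModule L M] [LieModule R L M] {e : L} {y : ℕ → M} {N i : ℕ}

lemma lie_sum_antidiagonal_tmul_eq_zero (h0 : ⁅e, y 0⁆ = 0)
    (hsucc : ∀ n < N, ⁅e, y (n + 1)⁆ = y n) (hi : i ≤ N) :
    ⁅e, ∑ p ∈ antidiagonal i, (-1 : R) ^ p.1 • (y p.1 ⊗ₜ[R] y p.2)⁆ = 0 := by
  have hlie : ∀ p : ℕ × ℕ, ⁅e, (-1 : R) ^ p.1 • (y p.1 ⊗ₜ[R] y p.2)⁆ =
      (-1 : R) ^ p.1 • (⁅e, y p.1⁆ ⊗ₜ[R] y p.2) + (-1 : R) ^ p.1 • (y p.1 ⊗ₜ[R] ⁅e, y p.2⁆) :=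
    fun p => by rw [lie_smul, TensorProduct.LieModule.lie_tmul_right, smul_add]
  rw [← toEnd_apply_apply R, map_sum]
  simp only [toEnd_apply_apply, hlie]
  cases i with
  | zero => simp [h0]
  | succ i =>
    rw [Finset.sum_add_distrib, Finset.Nat.sum_antidiagonal_succ, Finset.Nat.sum_antidiagonal_succ',
      h0, TensorProduct.zero_tmul, TensorProduct.tmul_zero, smul_zero, smul_zero, zero_add,
      zero_add, ← Finset.sum_add_distrib]
    refine Finset.sum_eq_zero fun p hp => ?_
    have hp := mem_antidiagonal.1 hp
    rw [hsucc _ (by omega), hsucc _ (by omega), pow_succ, ← add_smul]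
    simp

lemma toEnd_pow_apply_of_succ (hsucc : ∀ n < N, ⁅e, y (n + 1)⁆ = y n) {j : ℕ} (hj : j ≤ N) :
    (toEnd R L M e ^ j) (y j) = y 0 := by
  induction j with
  | zero => rfl
  | succ j ih =>
    rw [pow_succ, Module.End.mul_apply, toEnd_apply_apply, hsucc j hj, ih (by omega)]

end

lemma sum_antidiagonal_tmul_ne_zero {K L M : Type*} [Field K] [LieRing L] [LieAlgebra K L]
    [AddCommGroup M] [Module K M] [LieRingModule L M] [LieModule K L M] {e : L} {y : ℕ → M}
    {N i : ℕ} (hy : y 0 ≠ 0) (h0 : ⁅e, y 0⁆ = 0) (hsucc : ∀ n < N, ⁅e, y (n + 1)⁆ = y n)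
    (hi : i ≤ N) :
    ∑ p ∈ antidiagonal i, (-1 : K) ^ p.1 • (y p.1 ⊗ₜ[K] y p.2) ≠ 0 := by
  intro h
  have h' := congrArg (TensorProduct.map (toEnd K L M e ^ i) LinearMap.id) h
  rw [map_zero, map_sum, Finset.sum_eq_single (i, 0)] at h'
  · rw [map_smul, TensorProduct.map_tmul, toEnd_pow_apply_of_succ hsucc hi] at h'
    rw [smul_eq_zero_iff_right (pow_ne_zero _ (neg_ne_zero.2 one_ne_zero))] at h'
    obtain ⟨φ, hφ⟩ : ∃ φ : Module.Dual K M, φ (y 0) ≠ 0 := by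
      by_contra! hφ
      exact hy ((Module.forall_dual_apply_eq_zero_iff K _).1 hφ)
    simpa [hφ] using congrArg (LinearMap.mul' K K ∘ₗ TensorProduct.map φ φ) h'
  · rintro ⟨j, k⟩ hjk hne
    have hjk := mem_antidiagonal.1 hjk
    simp only at hjk
    have hk : k ≠ 0 := by
      rintro rfl
      exact hne (by rw [← hjk, add_zero])
    have hz : (toEnd K L M e ^ i) (y j) = 0 := by
      obtain ⟨k, rfl⟩ := Nat.exists_eq_succ_of_ne_zero hk
      rw [← hjk, show j + k.succ = k + 1 + j by omega, pow_add, Module.End.mul_apply,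
        toEnd_pow_apply_of_succ hsucc (by omega), pow_succ, Module.End.mul_apply,
        toEnd_apply_apply, h0, map_zero]
    rw [map_smul, TensorProduct.map_tmul, hz, TensorProduct.zero_tmul, smul_zero]
  · intro hni
    exact absurd (mem_antidiagonal.2 (add_zero i)) hni

variable {K : Type*} [Field K] {𝔤 : Type*} [LieRing 𝔤] [LieAlgebra K 𝔤] {H : LieSubalgebra K 𝔤}
  {Δ : Finset (Module.Dual K H)} {M : Type*} [AddCommGroup M] [Module K M] [LieRingModule 𝔤 M]
  [LieModule K 𝔤 M] {μ ν : Module.Dual K H}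

lemma tmul_mem_hWeightSpace {v w : M} (hv : v ∈ hWeightSpace K 𝔤 H M μ)
    (hw : w ∈ hWeightSpace K 𝔤 H M ν) : v ⊗ₜ[K] w ∈ hWeightSpace K 𝔤 H (M ⊗[K] M) (μ + ν) := by
  intro h
  rw [TensorProduct.LieModule.lie_tmul_right, hv h, hw h, TensorProduct.tmul_smul,
    ← TensorProduct.smul_tmul', LinearMap.add_apply, add_smul]

lemma pow_toEnd_mem_hWeightSpace {α : Module.Dual K H} {f : 𝔤} {v : M}
    (hf : f ∈ hRootSpace K 𝔤 H (-α)) (hv : v ∈ hWeightSpace K 𝔤 H M μ) (n : ℕ) :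
    (toEnd K 𝔤 M f ^ n) v ∈ hWeightSpace K 𝔤 H M (μ - n • α) := by
  induction n with
  | zero => simpa using hv
  | succ n ih =>
    rw [pow_succ', Module.End.mul_apply, toEnd_apply_apply]
    have := lie_mem_hWeightSpace hf ih
    rwa [show -α + (μ - n • α) = μ - (n + 1) • α by rw [succ_nsmul]; abel] at this

lemma lie_pow_toEnd_eq_zero {x f : 𝔤} {v : M} (hxf : ⁅x, f⁆ = 0) (hxv : ⁅x, v⁆ = 0) (n : ℕ) :
    ⁅x, (toEnd K 𝔤 M f ^ n) v⁆ = 0 := by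
  induction n with
  | zero => simpa using hxv
  | succ n ih =>
    rw [pow_succ', Module.End.mul_apply, toEnd_apply_apply, leibniz_lie, hxf, ih, zero_lie,
      lie_zero, add_zero]

/-- The highest weights of finite-dimensional modules are dominant integral. -/
lemma IsHighestWeightVector.exists_nat [CharZero K] [FiniteDimensional K M] {v : M}
    (hv : IsHighestWeightVector K 𝔤 H Δ M μ v) {β : Module.Dual K H} (hβ : β ∈ Δ) {h : H}
    (hh : IsCoroot K 𝔤 H β h) : ∃ m : ℕ, μ h = m := by
  obtain ⟨e, he, f, -, ht⟩ := hh.exists_isSl2Triple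
  have P : ht.HasPrimitiveVectorWith v (μ h) := ⟨hv.1, hv.2.1 h, hv.2.2 β hβ e he⟩
  exact P.exists_nat

variable [IsAlgClosed K] [CharZero K] [FiniteDimensional K 𝔤] [LieAlgebra.IsSemisimple K 𝔤]
  [H.IsCartanSubalgebra]

/-- The tensor square of a module with highest weight `μ` contains highest weight vectors of weight
`2μ - iα` for every simple root `α` and `0 ≤ i ≤ ⟨μ, α⟩`. -/
lemma IsRootBase.exists_isHighestWeightVector_tensorSquare (hΔ : IsRootBase K 𝔤 H Δ) {v : M}
    (hv : IsHighestWeightVector K 𝔤 H Δ M μ v) {α : Module.Dual K H} (hα : α ∈ Δ) {h : H}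
    (hh : IsCoroot K 𝔤 H α h) {N : ℕ} (hN : μ h = N) {i : ℕ} (hi : i ≤ N) :
    ∃ u, IsHighestWeightVector K 𝔤 H Δ (M ⊗[K] M) (2 • μ - i • α) u := by
  obtain ⟨e, he, f, hf, ht⟩ := hh.exists_isSl2Triple
  have P : ht.HasPrimitiveVectorWith v (N : K) := ⟨hv.1, hN ▸ hv.2.1 h, hv.2.2 α hα e he⟩
  let A : ℕ → K := fun n => ∏ m ∈ Finset.range n, ((m + 1) * (N - m) : K)
  let y : ℕ → M := fun n => (A n)⁻¹ • (toEnd K 𝔤 M f ^ n) v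
  have hy0 : y 0 = v := by simp [y, A]
  have h0 : ⁅e, y 0⁆ = 0 := by rw [hy0, P.lie_e]
  have hsucc : ∀ n < N, ⁅e, y (n + 1)⁆ = y n := by
    intro n hn
    have hne : ((n + 1) * (N - n) : K) ≠ 0 :=
      mul_ne_zero (by exact_mod_cast n.succ_ne_zero)
        (sub_ne_zero.2 (by exact_mod_cast hn.ne'))
    simp only [y, A, Finset.prod_range_succ, lie_smul, P.lie_e_pow_succ_toEnd_f, smul_smul]
    rw [mul_inv, mul_assoc, inv_mul_cancel₀ hne, mul_one]
  refine ⟨_, sum_antidiagonal_tmul_ne_zero (hy0 ▸ hv.1) h0 hsucc hi,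
    sum_mem fun p hp => Submodule.smul_mem _ _ ?_, fun β hβ x hx => ?_⟩
  · have hmem : ∀ n, y n ∈ hWeightSpace K 𝔤 H M (μ - n • α) := fun n =>
      Submodule.smul_mem _ _ (pow_toEnd_mem_hWeightSpace hf hv.2.1 n)
    have := tmul_mem_hWeightSpace (hmem p.1) (hmem p.2)
    rwa [show μ - p.1 • α + (μ - p.2 • α) = 2 • μ - i • α by
      rw [← mem_antidiagonal.1 hp, add_smul, two_smul]; abel] at this
  · by_cases hβα : β = α
    · subst hβα
      obtain ⟨t, rfl⟩ := (hΔ.1 β hβ).exists_eq_smul he ht.e_ne_zero hx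
      rw [smul_lie, lie_sum_antidiagonal_tmul_eq_zero h0 hsucc hi, smul_zero]
    · have hxf : ⁅x, f⁆ = 0 := hΔ.eq_zero_of_mem_hRootSpace_sub hβ hα hβα
        (sub_eq_add_neg β α ▸ lie_mem_hWeightSpace hx hf)
      have hxy : ∀ n, ⁅x, y n⁆ = 0 := fun n => by
        rw [lie_smul, lie_pow_toEnd_eq_zero hxf (hv.2.2 β hβ x hx), smul_zero]
      rw [← toEnd_apply_apply K, map_sum]
      refine Finset.sum_eq_zero fun p _ => ?_
      rw [toEnd_apply_apply, lie_smul, TensorProduct.LieModule.lie_tmul_right, hxy, hxy,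
        TensorProduct.zero_tmul, TensorProduct.tmul_zero, add_zero, smul_zero]

end TensorSquare

/-- Let `𝔤` be a finite-dimensional semisimple Lie algebra over an
algebraically closed field `K` of characteristic `0`, with Cartan subalgebra `H` and base `Δ`
of simple roots, and let `V` be the irreducible `𝔤`-module of highest weight `λ`.  Then for
every simple root `α ∈ Δ`, setting `t := ⟨λ, α⟩ = λ(hα) = N`, each weight `2λ - t'α` with
`0 ≤ t' ≤ t` is dominant integral, and the tensor square `V ⊗ V` contains a submodule
isomorphic to the direct sum `V(2λ) ⊕ V(2λ - α) ⊕ ⋯ ⊕ V(2λ - tα)`:  there is an independent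
family of Lie submodules `W_0, …, W_t` of `V ⊗ V` with `W_i` irreducible of highest weight
`2λ - iα`. -/
theorem tensorSquare_contains_directSum_of_highestWeights
    (K : Type*) [Field K] [IsAlgClosed K] [CharZero K]
    (𝔤 : Type*) [LieRing 𝔤] [LieAlgebra K 𝔤] [FiniteDimensional K 𝔤]
    [LieAlgebra.IsSemisimple K 𝔤]
    (H : LieSubalgebra K 𝔤) [H.IsCartanSubalgebra]
    (Δ : Finset (Module.Dual K H)) (hΔ : IsRootBase K 𝔤 H Δ)
    (V : Type*) [AddCommGroup V] [Module K V] [LieRingModule 𝔤 V] [LieModule K 𝔤 V]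
    [FiniteDimensional K V] [LieModule.IsIrreducible K 𝔤 V]
    (lam : Module.Dual K H) (hlam : IsHighestWeight K 𝔤 H Δ V lam)
    (α : Module.Dual K H) (hα : α ∈ Δ)
    (hcor : H) (hhcor : IsCoroot K 𝔤 H α hcor)
    (N : ℕ) (hN : lam hcor = (N : K)) :
    (∀ t' : ℕ, t' ≤ N → ∀ β ∈ Δ, ∀ hβ : H, IsCoroot K 𝔤 H β hβ →
        ∃ m : ℕ, (2 • lam - t' • α) hβ = (m : K)) ∧
      ∃ W : Fin (N + 1) → LieSubmodule K 𝔤 (V ⊗[K] V),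
        iSupIndep W ∧
          ∀ i : Fin (N + 1), LieModule.IsIrreducible K 𝔤 (W i) ∧
            ∃ v : V ⊗[K] V, v ∈ W i ∧
              IsHighestWeightVector K 𝔤 H Δ (V ⊗[K] V) (2 • lam - (i : ℕ) • α) v := by
  obtain ⟨v, hv⟩ := hlam
  have hu : ∀ i : ℕ, i ≤ N →
      ∃ u, IsHighestWeightVector K 𝔤 H Δ (V ⊗[K] V) (2 • lam - i • α) u := fun i hi =>
    hΔ.exists_isHighestWeightVector_tensorSquare hv hα hhcor hN hi
  refine ⟨fun t' ht' β hβ hβ' hcor' => ?_, ?_⟩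
  · obtain ⟨u, hu⟩ := hu t' ht'
    exact hu.exists_nat hβ hcor'
  have hW : ∀ i : Fin (N + 1), ∃ S : LieSubmodule K 𝔤 (V ⊗[K] V), LieModule.IsIrreducible K 𝔤 S ∧
      ∃ v ∈ S, IsHighestWeightVector K 𝔤 H Δ (V ⊗[K] V) (2 • lam - (i : ℕ) • α) v := fun i => by
    obtain ⟨u, hu⟩ := hu i (Nat.lt_succ_iff.1 i.isLt)
    exact exists_isIrreducible_highestWeightVector hu
  choose W hirr hW using hW
  obtain ⟨h₀, hh₀⟩ := hΔ.exists_apply_eq_one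
  refine ⟨W, iSupIndep_of_highestWeight_apply_injective (Δ := Δ)
    (χ := fun i : Fin (N + 1) => 2 • lam - (i : ℕ) • α) h₀ (fun i j hij => ?_) hW
    fun i w hw ν hν => ?_, fun i => ⟨hirr i, hW i⟩⟩
  · simpa [hh₀ α hα, Fin.ext_iff] using hij
  · obtain ⟨u, huW, hu⟩ := hW i
    have hu' : IsHighestWeightVector K 𝔤 H Δ (W i) (2 • lam - (i : ℕ) • α) ⟨u, huW⟩ :=
      ⟨fun h => hu.1 (congrArg Subtype.val h), (coe_mem_highestWeightSpace (W i) ⟨u, huW⟩).1 hu.2⟩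
    have hw' : IsHighestWeightVector K 𝔤 H Δ (W i) ν ⟨w, hw⟩ :=
      ⟨fun h => hν.1 (congrArg Subtype.val h), (coe_mem_highestWeightSpace (W i) ⟨w, hw⟩).1 hν.2⟩
    exact hΔ.highestWeight_apply_eq hh₀ hu' hw'
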